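/- Let H be a real Hilbert space, let ℓ > 0, let 0 < η < 1/(2ℓ), let ε ≥ 0, D > 0, and let T ≥ 1 be an integer. For each t = 1,…,T let L_t : H → ℝ be convex and differentiable with gradient ∇L_t Lipschitz with constant ℓ, and let f_t★ ∈ H be a global minimizer of L_t. Let f_1,…,f_{T+1} ∈ H satisfy the inexact gradient step ‖f_{t+1} − (f_t − η ∇L_t(f_t))‖ ≤ ε and the bound ‖f_t − f_t★‖ ≤ D for all t = 1,…,T. Then the dynamic regret satisfies Σ_{t=1}^T (L_t(f_t) − L_t(f_t★)) ≤ (D/(η(1 − 2ηℓ))) · ( ‖f_1 − f_1★‖ + T·√(2εD + 2ε²) + Σ_{t=1}^{T−1} ‖f_{t+1}★ − f_t★‖ ). -/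

import Mathlib

theorem aux_first_order {H : Type*} [NormedAddCommGroup H] [InnerProductSpace ℝ H]
    [CompleteSpace H] (L : H → ℝ) (g : H) (x y : H) (hc : ConvexOn ℝ Set.univ L)
    (hg : HasGradientAt L g x) : L x + inner ℝ g (y - x) ≤ L y := by
  have hc2 : ConvexOn ℝ Set.univ (L ∘ (AffineMap.lineMap x y : ℝ →ᵃ[ℝ] H)) := by
    simpa using hc.comp_affineMap (AffineMap.lineMap x y : ℝ →ᵃ[ℝ] H)
  have hd : HasDerivAt (L ∘ (AffineMap.lineMap x y : ℝ →ᵃ[ℝ] H)) (inner ℝ g (y - x)) 0 := by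
    have h1 : HasDerivAt (AffineMap.lineMap x y : ℝ →ᵃ[ℝ] H) (y - x) (0 : ℝ) :=
      AffineMap.hasDerivAt_lineMap
    have h2 : HasFDerivAt L (InnerProductSpace.toDual ℝ H g)
        ((AffineMap.lineMap x y : ℝ →ᵃ[ℝ] H) 0) := by
      simpa using hg.hasFDerivAt
    simpa using h2.comp_hasDerivAt (0 : ℝ) h1
  have h := hc2.le_slope_of_hasDerivAt (Set.mem_univ (0 : ℝ)) (Set.mem_univ (1 : ℝ))
    zero_lt_one hd
  simp [slope_def_field] at h
  linarith

theorem aux_grad_sq {H : Type*} [NormedAddCommGroup H] [InnerProductSpace ℝ H]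
    [CompleteSpace H] (ℓ : ℝ) (hℓ : 0 < ℓ) (L : H → ℝ) (L' : H → H)
    (hc : ConvexOn ℝ Set.univ L) (hg : ∀ x, HasGradientAt L (L' x) x)
    (hlip : ∀ f g : H, ‖L' f - L' g‖ ≤ ℓ * ‖f - g‖) (z : H) (hz : ∀ f, L z ≤ L f) (x : H) :
    ‖L' x‖ ^ 2 ≤ 4 * ℓ * (L x - L z) := by
  set y := x - (1 / (2 * ℓ)) • L' x with hy
  have h1 := aux_first_order L (L' y) y x hc (hg y)
  have hxy : x - y = (1 / (2 * ℓ)) • L' x := by simp [hy]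
  have h2 : |inner ℝ (L' x - L' y) (x - y)| ≤ ‖L' x - L' y‖ * ‖x - y‖ :=
    abs_real_inner_le_norm _ _
  have h3 := hlip x y
  have h4 : ‖x - y‖ = 1 / (2 * ℓ) * ‖L' x‖ := by
    rw [hxy, norm_smul, Real.norm_of_nonneg (by positivity)]
  have h5 : inner ℝ (L' x) (x - y) = 1 / (2 * ℓ) * ‖L' x‖ ^ 2 := by
    rw [hxy, inner_smul_right, real_inner_self_eq_norm_sq]
  have h6 := (abs_le.mp h2).2
  rw [inner_sub_left, h5] at h6
  have h7 : ‖L' x - L' y‖ * ‖x - y‖ ≤ ℓ * ‖x - y‖ * ‖x - y‖ :=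
    mul_le_mul_of_nonneg_right h3 (norm_nonneg _)
  have h8 : ℓ * ‖x - y‖ * ‖x - y‖ = 1 / (4 * ℓ) * ‖L' x‖ ^ 2 := by
    rw [h4]; field_simp; ring
  have h9 : 1 / (2 * ℓ) * ‖L' x‖ ^ 2 = 2 * (1 / (4 * ℓ) * ‖L' x‖ ^ 2) := by
    field_simp; ring
  have h10 : 1 / (4 * ℓ) * ‖L' x‖ ^ 2 ≤ L x - L z := by
    have := hz y
    linarith
  have h11 : ‖L' x‖ ^ 2 = 4 * ℓ * (1 / (4 * ℓ) * ‖L' x‖ ^ 2) := by field_simp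
  rw [h11]
  exact mul_le_mul_of_nonneg_left h10 (by positivity)

theorem aux_step {H : Type*} [NormedAddCommGroup H] [InnerProductSpace ℝ H]
    [CompleteSpace H] (ℓ η D : ℝ) (hℓ : 0 < ℓ) (hη : 0 < η) (hc0 : 0 < 1 - 2 * η * ℓ)
    (L : H → ℝ) (L' : H → H)
    (hc : ConvexOn ℝ Set.univ L) (hg : ∀ x, HasGradientAt L (L' x) x)
    (hlip : ∀ f g : H, ‖L' f - L' g‖ ≤ ℓ * ‖f - g‖) (z : H) (hz : ∀ f, L z ≤ L f) (x : H)
    (hD : ‖x - z‖ ≤ D) :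
    η * (1 - 2 * η * ℓ) * (L x - L z) ≤ D * (‖x - z‖ - ‖x - η • L' x - z‖) := by
  have h1 := aux_grad_sq ℓ hℓ L L' hc hg hlip z hz x
  have h2 := aux_first_order L (L' x) x z hc (hg x)
  have h3 : ‖x - η • L' x - z‖ ^ 2
      = ‖x - z‖ ^ 2 + 2 * η * inner ℝ (L' x) (z - x) + η ^ 2 * ‖L' x‖ ^ 2 := by
    have : x - η • L' x - z = (x - z) - η • L' x := by abel
    rw [this, norm_sub_sq_real, inner_smul_right, norm_smul, Real.norm_of_nonneg hη.le,
      real_inner_comm, ← neg_sub x z, inner_neg_right]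
    ring
  have hΔ : 0 ≤ L x - L z := sub_nonneg.mpr (hz x)
  have h4 : ‖x - η • L' x - z‖ ^ 2 + 2 * (η * (1 - 2 * η * ℓ) * (L x - L z)) ≤ ‖x - z‖ ^ 2 := by
    have a := mul_le_mul_of_nonneg_left h1 (sq_nonneg η)
    have b : η * inner ℝ (L' x) (z - x) ≤ η * (L z - L x) :=
      mul_le_mul_of_nonneg_left (by linarith) hη.le
    nlinarith
  have h5 : 0 ≤ η * (1 - 2 * η * ℓ) * (L x - L z) := by positivity
  have h6 : ‖x - η • L' x - z‖ ≤ ‖x - z‖ :=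
    (le_abs_self _).trans (abs_le_of_sq_le_sq (by linarith) (norm_nonneg _))
  nlinarith [mul_nonneg (sub_nonneg.mpr h6) (sub_nonneg.mpr hD),
    mul_nonneg (sub_nonneg.mpr h6) (sub_nonneg.mpr (h6.trans hD))]

/-- Theorem 2(i), explicit form: dynamic regret of inexact gradient descent for convex
smooth losses in terms of the path length and the compression budget. -/
theorem stmt_8 {H : Type*} [NormedAddCommGroup H] [InnerProductSpace ℝ H] [CompleteSpace H]
    (ℓ η ε D : ℝ) (hℓ : 0 < ℓ) (hη : 0 < η) (hηℓ : η < 1 / (2 * ℓ)) (hε : 0 ≤ ε) (hD : 0 < D)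
    (T : ℕ) (hT : 1 ≤ T)
    (L : ℕ → H → ℝ) (L' : ℕ → H → H)
    (hconv : ∀ t ∈ Finset.Icc 1 T, ConvexOn ℝ Set.univ (L t))
    (hgrad : ∀ t ∈ Finset.Icc 1 T, ∀ x : H, HasGradientAt (L t) (L' t x) x)
    (hlip : ∀ t ∈ Finset.Icc 1 T, ∀ f g : H, ‖L' t f - L' t g‖ ≤ ℓ * ‖f - g‖)
    (fstar : ℕ → H) (hmin : ∀ t ∈ Finset.Icc 1 T, ∀ f : H, L t (fstar t) ≤ L t f)
    (f : ℕ → H)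
    (hstep : ∀ t ∈ Finset.Icc 1 T, ‖f (t + 1) - (f t - η • L' t (f t))‖ ≤ ε)
    (hdist : ∀ t ∈ Finset.Icc 1 T, ‖f t - fstar t‖ ≤ D) :
    ∑ t ∈ Finset.Icc 1 T, (L t (f t) - L t (fstar t)) ≤
      (D / (η * (1 - 2 * η * ℓ))) *
        (‖f 1 - fstar 1‖ + T * Real.sqrt (2 * ε * D + 2 * ε ^ 2)
          + ∑ t ∈ Finset.Icc 1 (T - 1), ‖fstar (t + 1) - fstar t‖) := by
  have hc0 : 0 < 1 - 2 * η * ℓ := by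
    rw [lt_div_iff₀ (by positivity)] at hηℓ
    linarith
  have hs : ε ≤ Real.sqrt (2 * ε * D + 2 * ε ^ 2) := by
    apply Real.le_sqrt_of_sq_le
    have := mul_nonneg hε hD.le
    nlinarith [sq_nonneg ε]
  obtain ⟨m, rfl⟩ : ∃ m, T = m + 1 := ⟨T - 1, by omega⟩
  have hst : ∀ t ∈ Finset.Icc 1 (m + 1), η * (1 - 2 * η * ℓ) * (L t (f t) - L t (fstar t)) ≤
      D * (‖f t - fstar t‖ - ‖f t - η • L' t (f t) - fstar t‖) := fun t ht =>
    aux_step ℓ η D hℓ hη hc0 (L t) (L' t) (hconv t ht) (hgrad t ht) (hlip t ht) (fstar t)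
      (hmin t ht) (f t) (hdist t ht)
  have key : ∀ n, n ≤ m →
      η * (1 - 2 * η * ℓ) * ∑ t ∈ Finset.Icc 1 n, (L t (f t) - L t (fstar t)) ≤
      D * (‖f 1 - fstar 1‖ - ‖f (n + 1) - fstar (n + 1)‖ + n * ε
        + ∑ t ∈ Finset.Icc 1 n, ‖fstar (t + 1) - fstar t‖) := by
    intro n
    induction n with
    | zero => intro _; simp
    | succ n ih =>
      intro hn
      have ih := ih (by omega)
      have hmem : n + 1 ∈ Finset.Icc 1 (m + 1) := by simp; omega
      have a := hst _ hmem
      have b := hstep _ hmem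
      rw [Finset.sum_Icc_succ_top (by omega), Finset.sum_Icc_succ_top (by omega)]
      have c : ‖f (n + 1 + 1) - fstar (n + 1 + 1)‖ ≤
          ‖f (n + 1) - η • L' (n + 1) (f (n + 1)) - fstar (n + 1)‖ + ε
          + ‖fstar (n + 1 + 1) - fstar (n + 1)‖ := by
        have e : f (n + 1 + 1) - fstar (n + 1 + 1) =
          (f (n + 1) - η • L' (n + 1) (f (n + 1)) - fstar (n + 1))
          + (f (n + 1 + 1) - (f (n + 1) - η • L' (n + 1) (f (n + 1))))
          - (fstar (n + 1 + 1) - fstar (n + 1)) := by abel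
        rw [e]
        refine (norm_sub_le _ _).trans ?_
        have := norm_add_le (f (n + 1) - η • L' (n + 1) (f (n + 1)) - fstar (n + 1))
          (f (n + 1 + 1) - (f (n + 1) - η • L' (n + 1) (f (n + 1))))
        linarith
      have d := mul_le_mul_of_nonneg_left c hD.le
      push_cast
      linarith
  have k := key m le_rfl
  have l := hst (m + 1) (by simp)
  have p := mul_nonneg hD.le (norm_nonneg
    (f (m + 1) - η • L' (m + 1) (f (m + 1)) - fstar (m + 1)))
  rw [div_mul_eq_mul_div, le_div_iff₀ (by positivity), Finset.sum_Icc_succ_top (by omega),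
    Nat.add_sub_cancel]
  have q : (m : ℝ) * ε ≤ ((m + 1 : ℕ) : ℝ) * Real.sqrt (2 * ε * D + 2 * ε ^ 2) := by
    apply mul_le_mul _ hs hε (by positivity)
    push_cast; linarith
  have r := mul_le_mul_of_nonneg_left q hD.le
  linarith
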